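/- arXiv:2311.14980 — 5 statements merged into one kernel-verified Lean document; each statement's English description precedes it below -/
import Mathlib

section
/- Let f : [0,∞) → [0,∞) be a nonnegative continuous function, C > 0 a constant, and g, h : [0,∞) → [0,∞) nonnegative continuous functions such that f(t) ≤ C + g(t)·f(t) + ∫₀ᵗ h(s)·f(s) ds for all t ≥ 0. Assume that the function t ↦ ∫₀ᵗ h(s) ds is bounded on [0,∞) and that g(t) → 0 as t → ∞. Then f is bounded on [0,∞). -/
open MeasureTheory Filter

/-- Integral form of Grönwall's inequality on the half-line, with a constant forcing term. -/
theorem le_mul_exp_integral_of_le_add_integral {f k : ℝ → ℝ} {K : ℝ}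
    (hf : ContinuousOn f (Set.Ici 0)) (hk : ContinuousOn k (Set.Ici 0))
    (hk_nonneg : ∀ t ∈ Set.Ici (0 : ℝ), 0 ≤ k t)
    (h : ∀ t ≥ (0 : ℝ), f t ≤ K + ∫ s in (0 : ℝ)..t, k s * f s) {t : ℝ} (ht : 0 ≤ t) :
    f t ≤ K * Real.exp (∫ s in (0 : ℝ)..t, k s) := by
  have int_of_contOn {u : ℝ → ℝ} (hu : ContinuousOn u (Set.Ici 0)) {x : ℝ} (hx : 0 ≤ x) :
      IntervalIntegrable u volume 0 x :=
    (hu.mono fun y hy ↦ (Set.uIcc_of_le hx ▸ hy).1).intervalIntegrable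
  have deriv_int {u : ℝ → ℝ} (hu : ContinuousOn u (Set.Ici 0)) {x : ℝ} (hx : 0 < x) :
      HasDerivAt (fun y ↦ ∫ s in (0 : ℝ)..y, u s) (u x) x :=
    intervalIntegral.integral_hasDerivAt_right (int_of_contOn hu hx.le)
      ((hu.mono Set.Ioi_subset_Ici_self).stronglyMeasurableAtFilter isOpen_Ioi x hx)
      (hu.continuousAt (Ici_mem_nhds hx))
  have cont_int {u : ℝ → ℝ} (hu : ContinuousOn u (Set.Ici 0)) :
      ContinuousOn (fun y ↦ ∫ s in (0 : ℝ)..y, u s) (Set.Icc 0 t) := by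
    simpa only [Set.uIcc_of_le ht] using intervalIntegral.continuousOn_primitive_interval
      ((intervalIntegrable_iff' (by finiteness)).1 (int_of_contOn hu ht))
  have hkf : ContinuousOn (fun s ↦ k s * f s) (Set.Ici 0) := hk.mul hf
  have hderiv (x : ℝ) (hx : 0 < x) := ((deriv_int hkf hx).const_add K).mul (deriv_int hk hx).neg.exp
  have hanti : AntitoneOn (fun y ↦ (K + ∫ s in (0 : ℝ)..y, k s * f s) *
      Real.exp (-∫ s in (0 : ℝ)..y, k s)) (Set.Icc 0 t) := by
    refine antitoneOn_of_hasDerivWithinAt_nonpos (convex_Icc 0 t)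
      (((cont_int hkf).const_add K).mul (cont_int hk).neg.rexp)
      (fun x hx ↦ (hderiv x (interior_Icc (a := (0 : ℝ)) ▸ hx).1).hasDerivWithinAt) fun x hx ↦ ?_
    rw [interior_Icc] at hx
    have := mul_nonneg (mul_nonneg (hk_nonneg x hx.1.le) (sub_nonneg.2 (h x hx.1.le)))
      (Real.exp_pos (-∫ s in (0 : ℝ)..x, k s)).le
    simp only [Pi.neg_apply]
    linarith
  have hle := hanti (Set.left_mem_Icc.2 ht) (Set.right_mem_Icc.2 ht) ht
  simp only [intervalIntegral.integral_same, add_zero, neg_zero, Real.exp_zero, mul_one,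
    Real.exp_neg, ← div_eq_mul_inv] at hle
  exact (h t ht).trans ((div_le_iff₀ (Real.exp_pos _)).1 hle)

/-- Grönwall-type lemma, case β = 1: if a nonnegative continuous `f` satisfies
`f t ≤ C + g t * f t + ∫₀ᵗ h s * f s ds` on `[0,∞)`, where `t ↦ ∫₀ᵗ h` is bounded
and `g → 0` at infinity, then `f` is bounded on `[0,∞)`. -/
theorem gronwall_beta_one
    (f g h : ℝ → ℝ) (C : ℝ) (hC : 0 < C)
    (hf_cont : ContinuousOn f (Set.Ici 0))
    (hg_cont : ContinuousOn g (Set.Ici 0))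
    (hh_cont : ContinuousOn h (Set.Ici 0))
    (hf_nonneg : ∀ t ∈ Set.Ici (0:ℝ), 0 ≤ f t)
    (hg_nonneg : ∀ t ∈ Set.Ici (0:ℝ), 0 ≤ g t)
    (hh_nonneg : ∀ t ∈ Set.Ici (0:ℝ), 0 ≤ h t)
    (hineq : ∀ t ≥ (0:ℝ), f t ≤ C + g t * f t + ∫ s in (0:ℝ)..t, h s * f s)
    (hH_bdd : ∃ M : ℝ, ∀ t ≥ (0:ℝ), (∫ s in (0:ℝ)..t, h s) ≤ M)
    (hg_lim : Tendsto g atTop (nhds 0)) :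
    ∃ B : ℝ, ∀ t ≥ (0:ℝ), f t ≤ B := by
  obtain ⟨M, hM⟩ := hH_bdd
  obtain ⟨T, hT⟩ := eventually_atTop.1 (hg_lim.eventually_le_const (by norm_num : (0 : ℝ) < 1 / 2))
  obtain ⟨A, hA⟩ := (isCompact_Icc (a := (0 : ℝ)) (b := T)).bddAbove_image
    (hf_cont.mono Set.Icc_subset_Ici_self)
  have hK : 0 ≤ max A (2 * C) := le_max_of_le_right (by positivity)
  have hbound : ∀ t ≥ (0 : ℝ), f t ≤ max A (2 * C) + ∫ s in (0 : ℝ)..t, 2 * h s * f s := by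
    intro t ht
    have hI : 0 ≤ ∫ s in (0 : ℝ)..t, h s * f s :=
      intervalIntegral.integral_nonneg ht fun s hs ↦
        mul_nonneg (hh_nonneg s hs.1) (hf_nonneg s hs.1)
    simp only [mul_assoc, intervalIntegral.integral_const_mul]
    rcases le_total t T with htT | htT
    · have := hA (Set.mem_image_of_mem f ⟨ht, htT⟩)
      linarith [le_max_left A (2 * C)]
    · have := mul_le_mul_of_nonneg_right (hT t htT) (hf_nonneg t ht)
      linarith [le_max_right A (2 * C), hineq t ht]
  refine ⟨max A (2 * C) * Real.exp (2 * M), fun t ht ↦ ?_⟩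
  refine (le_mul_exp_integral_of_le_add_integral hf_cont (hh_cont.const_mul 2)
    (fun s hs ↦ mul_nonneg zero_le_two (hh_nonneg s hs)) hbound ht).trans ?_
  rw [intervalIntegral.integral_const_mul]
  gcongr
  exact hM t ht
end

section
/- Let 0 < β < 1, let f : [0,∞) → [0,∞) be a nonnegative continuous function, C > 0 a constant, and g, h : [0,∞) → [0,∞) nonnegative continuous functions such that f(t) ≤ C + g(t)·(f(t))^β + ∫₀ᵗ h(s)·(f(s))^β ds for all t ≥ 0. Assume that the function t ↦ ∫₀ᵗ h(s) ds is bounded on [0,∞) and that g is bounded on [0,∞). Then f is bounded on [0,∞). -/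
open MeasureTheory Filter

/-- A nonnegative real dominated by a sublinear power of itself is bounded in terms of the
coefficients alone. -/
lemma le_max_one_rpow_of_le_add_mul_rpow {β C K x : ℝ} (hβ0 : 0 ≤ β) (hβ1 : β < 1)
    (hC : 0 ≤ C) (h : x ≤ C + K * x ^ β) :
    x ≤ max 1 ((C + K) ^ (1 - β)⁻¹) := by
  rcases le_total x 1 with hx | hx
  · exact hx.trans (le_max_left _ _)
  refine le_trans ?_ (le_max_right _ _)
  have hx0 : 0 < x := zero_lt_one.trans_le hx
  have hpow : 0 < x ^ β := Real.rpow_pos_of_pos hx0 β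
  have hx' : x ≤ (C + K) * x ^ β := by
    nlinarith [Real.one_le_rpow hx hβ0]
  have hquot : x ^ (1 - β) ≤ C + K := by
    rw [Real.rpow_sub hx0, Real.rpow_one]
    exact (div_le_iff₀ hpow).2 hx'
  have hβ : 0 < 1 - β := sub_pos.2 hβ1
  calc x = (x ^ (1 - β)) ^ (1 - β)⁻¹ := (Real.rpow_rpow_inv hx0.le hβ.ne').symm
    _ ≤ (C + K) ^ (1 - β)⁻¹ :=
      Real.rpow_le_rpow (Real.rpow_nonneg hx0.le _) hquot (inv_nonneg.2 hβ.le)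

/-- Grönwall-type lemma, case 0 < β < 1: if a nonnegative continuous `f` satisfies
`f t ≤ C + g t * (f t)^β + ∫₀ᵗ h s * (f s)^β ds` on `[0,∞)`, where `t ↦ ∫₀ᵗ h` is
bounded and `g` is bounded, then `f` is bounded on `[0,∞)`. -/
theorem gronwall_beta_lt_one
    (β : ℝ) (hβ0 : 0 < β) (hβ1 : β < 1)
    (f g h : ℝ → ℝ) (C : ℝ) (hC : 0 < C)
    (hf_cont : ContinuousOn f (Set.Ici 0))
    (hg_cont : ContinuousOn g (Set.Ici 0))
    (hh_cont : ContinuousOn h (Set.Ici 0))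
    (hf_nonneg : ∀ t ∈ Set.Ici (0:ℝ), 0 ≤ f t)
    (hg_nonneg : ∀ t ∈ Set.Ici (0:ℝ), 0 ≤ g t)
    (hh_nonneg : ∀ t ∈ Set.Ici (0:ℝ), 0 ≤ h t)
    (hineq : ∀ t ≥ (0:ℝ), f t ≤ C + g t * (f t) ^ β + ∫ s in (0:ℝ)..t, h s * (f s) ^ β)
    (hH_bdd : ∃ M : ℝ, ∀ t ≥ (0:ℝ), (∫ s in (0:ℝ)..t, h s) ≤ M)
    (hg_bdd : ∃ G : ℝ, ∀ t ≥ (0:ℝ), g t ≤ G) :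
    ∃ B : ℝ, ∀ t ≥ (0:ℝ), f t ≤ B := by
  obtain ⟨M, hM⟩ := hH_bdd
  obtain ⟨G, hG⟩ := hg_bdd
  refine ⟨max 1 ((C + (G + M)) ^ (1 - β)⁻¹), fun T hT => ?_⟩
  obtain ⟨t, ⟨ht0, htT⟩, hmax⟩ := isCompact_Icc.exists_isMaxOn
    (Set.nonempty_Icc.2 hT) (hf_cont.mono Set.Icc_subset_Ici_self)
  refine (hmax (Set.right_mem_Icc.2 hT)).trans
    (le_max_one_rpow_of_le_add_mul_rpow hβ0.le hβ1 hC.le ?_)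
  have hpow : 0 ≤ f t ^ β := Real.rpow_nonneg (hf_nonneg t ht0) β
  have hh : ContinuousOn h (Set.uIcc 0 t) := by
    rw [Set.uIcc_of_le ht0]
    exact hh_cont.mono Set.Icc_subset_Ici_self
  have hf : ContinuousOn f (Set.uIcc 0 t) := by
    rw [Set.uIcc_of_le ht0]
    exact hf_cont.mono Set.Icc_subset_Ici_self
  have hint : ∫ s in (0:ℝ)..t, h s * f s ^ β ≤ M * f t ^ β :=
    calc ∫ s in (0:ℝ)..t, h s * f s ^ β ≤ ∫ s in (0:ℝ)..t, h s * f t ^ β := by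
          refine intervalIntegral.integral_mono_on ht0
            (hh.mul (hf.rpow_const fun _ _ => Or.inr hβ0.le)).intervalIntegrable
            (hh.mul continuousOn_const).intervalIntegrable fun s hs => ?_
          exact mul_le_mul_of_nonneg_left
            (Real.rpow_le_rpow (hf_nonneg s hs.1) (hmax ⟨hs.1, hs.2.trans htT⟩) hβ0.le)
            (hh_nonneg s hs.1)
      _ = (∫ s in (0:ℝ)..t, h s) * f t ^ β := intervalIntegral.integral_mul_const _ _
      _ ≤ M * f t ^ β := mul_le_mul_of_nonneg_right (hM t ht0) hpow
  calc f t ≤ C + g t * f t ^ β + ∫ s in (0:ℝ)..t, h s * f s ^ β := hineq t ht0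
    _ ≤ C + G * f t ^ β + M * f t ^ β :=
      add_le_add (add_le_add_right (mul_le_mul_of_nonneg_right (hG t ht0) hpow) C) hint
    _ = C + (G + M) * f t ^ β := by ring
end

section
/- Let I ⊂ ℝ be an interval and let X : I → [0,∞) be a continuous function satisfying X(t) ≤ a + b·(X(t))^θ for every t ∈ I, where a, b > 0 and θ > 1 are constants. Assume that for some t₀ ∈ I one has X(t₀) ≤ a, and that a·b^{1/(θ−1)} < (θ−1)·θ^{θ/(1−θ)}. Then X(t) < θ·a/(θ−1) for every t ∈ I. -/
/-- Under the smallness condition, `θ a / (θ - 1)` violates the inequality `x ≤ a + b x ^ θ`. -/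
theorem add_mul_rpow_lt_of_small {a b θ : ℝ} (ha : 0 < a) (hb : 0 < b) (hθ : 1 < θ)
    (hsmall : a * b ^ (1 / (θ - 1)) < (θ - 1) * θ ^ (θ / (1 - θ))) :
    a + b * (θ * a / (θ - 1)) ^ θ < θ * a / (θ - 1) := by
  have hθ0 : 0 < θ := by linarith
  have hθ1 : 0 < θ - 1 := by linarith
  have hne : θ - 1 ≠ 0 := hθ1.ne'
  have hne' : 1 - θ ≠ 0 := by linarith
  set c := θ * a / (θ - 1) with hc
  have hc0 : 0 < c := by positivity
  have hca : c * (θ - 1) = θ * a := by rw [hc]; field_simp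
  have hexp : θ * θ ^ (θ / (1 - θ)) = θ ^ (1 / (1 - θ)) := by
    rw [← Real.rpow_one_add' hθ0.le (by field_simp; simpa using hne')]
    congr 1
    field_simp
    ring
  have hroot : c * b ^ (1 / (θ - 1)) < θ ^ (1 / (1 - θ)) := by
    rw [← hexp]
    refine lt_of_mul_lt_mul_right ?_ hθ1.le
    calc c * b ^ (1 / (θ - 1)) * (θ - 1) = θ * (a * b ^ (1 / (θ - 1))) := by
          linear_combination b ^ (1 / (θ - 1)) * hca
      _ < θ * ((θ - 1) * θ ^ (θ / (1 - θ))) := by gcongr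
      _ = θ * θ ^ (θ / (1 - θ)) * (θ - 1) := by ring
  have hpow : c ^ (θ - 1) * b < θ⁻¹ := by
    have h := Real.rpow_lt_rpow (by positivity) hroot hθ1
    rwa [Real.mul_rpow hc0.le (by positivity), ← Real.rpow_mul hb.le, ← Real.rpow_mul hθ0.le,
      one_div_mul_cancel hne, Real.rpow_one,
      show 1 / (1 - θ) * (θ - 1) = -1 by field_simp; ring, Real.rpow_neg_one] at h
  have hsplit : c ^ θ = c ^ (θ - 1) * c := by
    rw [Real.rpow_sub_one hc0.ne', div_mul_cancel₀ _ hc0.ne']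
  calc a + b * c ^ θ = a + c ^ (θ - 1) * b * c := by rw [hsplit]; ring
    _ < a + θ⁻¹ * c := by gcongr
    _ = c := by rw [hc]; field_simp; ring

/-- Bootstrap (continuity) argument: if a continuous nonnegative `X` on an interval `I`
satisfies `X t ≤ a + b (X t)^θ` with `a, b > 0`, `θ > 1`, `X t₀ ≤ a` for some `t₀ ∈ I`,
and `a b^{1/(θ−1)} < (θ−1) θ^{θ/(1−θ)}`, then `X t < θ a/(θ−1)` on all of `I`. -/
theorem bootstrap_argument
    (I : Set ℝ) (hI : I.OrdConnected)
    (X : ℝ → ℝ) (hX_cont : ContinuousOn X I)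
    (hX_nonneg : ∀ t ∈ I, 0 ≤ X t)
    (a b θ : ℝ) (ha : 0 < a) (hb : 0 < b) (hθ : 1 < θ)
    (hineq : ∀ t ∈ I, X t ≤ a + b * (X t) ^ θ)
    (t₀ : ℝ) (ht₀ : t₀ ∈ I) (hX₀ : X t₀ ≤ a)
    (hsmall : a * b ^ (1 / (θ - 1)) < (θ - 1) * θ ^ (θ / (1 - θ))) :
    ∀ t ∈ I, X t < θ * a / (θ - 1) := by
  intro t ht
  by_contra! hct
  have hac : a ≤ θ * a / (θ - 1) := by
    rw [le_div_iff₀ (by linarith)]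
    linarith
  obtain ⟨s, hs, hXs⟩ := hI.isPreconnected.intermediate_value ht₀ ht hX_cont
    ⟨hX₀.trans hac, hct⟩
  have h := hineq s hs
  rw [hXs] at h
  exact (add_mul_rpow_lt_of_small ha hb hθ hsmall).not_ge h
end

section
/- Let N ≥ 1 and let p satisfy 1 < p < 1 + 4/(N−2) if N ≥ 3 (and 1 < p < ∞ if N = 1, 2). Set σ = N(p−1)/2. Then there exists a constant K > 0 such that for every compactly supported function u : ℝ^N → ℂ of class C¹, ∫_{ℝ^N} |u(x)|^{p+1} dx ≤ K · ‖u‖_{L²}^{p+1−σ} · ‖∇u‖_{L²}^{σ}, where ‖u‖_{L²} = (∫_{ℝ^N} |u(x)|² dx)^{1/2} and ‖∇u‖_{L²} = (∫_{ℝ^N} ‖Du(x)‖² dx)^{1/2} with Du(x) the Fréchet derivative of u at x. -/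
open MeasureTheory

open scoped NNReal ENNReal

/-- Interpolation of `∫ f ^ q` between `∫ f ^ r` and `∫ f ^ s` for `q = (1 - θ) r + θ s`. -/
theorem lintegral_rpow_le_interpolation {α : Type*} [MeasurableSpace α] {μ : Measure α}
    {f : α → ℝ≥0∞} (hf : AEMeasurable f μ) {q r s θ : ℝ} (hr : 0 ≤ r) (hs : 0 ≤ s)
    (hθ₀ : 0 ≤ θ) (hθ₁ : θ ≤ 1) (hq : q = (1 - θ) * r + θ * s) :
    ∫⁻ x, f x ^ q ∂μ ≤ (∫⁻ x, f x ^ r ∂μ) ^ (1 - θ) * (∫⁻ x, f x ^ s ∂μ) ^ θ := by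
  have hθ : 0 ≤ 1 - θ := sub_nonneg.2 hθ₁
  refine le_trans (le_of_eq ?_) (ENNReal.lintegral_mul_norm_pow_le (hf.pow_const r)
    (hf.pow_const s) hθ hθ₀ (sub_add_cancel 1 θ))
  refine lintegral_congr fun x ↦ ?_
  rw [← ENNReal.rpow_mul, ← ENNReal.rpow_mul, hq, mul_comm (1 - θ), mul_comm θ,
    ENNReal.rpow_add_of_nonneg _ _ (mul_nonneg hr hθ) (mul_nonneg hs hθ₀)]

/-- If `∫ f ^ r` is bounded by a multiple of `(∫ f ^ 2) ^ a * G ^ b`, then the intermediate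
moments of `f` satisfy the corresponding interpolated bound. -/
theorem lintegral_rpow_le_of_endpoint {α : Type*} [MeasurableSpace α] {μ : Measure α}
    {f : α → ℝ≥0∞} (hf : AEMeasurable f μ) {q r θ a b : ℝ} {C : ℝ≥0} {G : ℝ≥0∞} (hr : 0 ≤ r)
    (hθ₀ : 0 ≤ θ) (hθ₁ : θ ≤ 1) (ha : 0 ≤ a) (hq : q = (1 - θ) * 2 + θ * r)
    (h : ∫⁻ x, f x ^ r ∂μ ≤ C * (∫⁻ x, f x ^ (2 : ℝ) ∂μ) ^ a * G ^ b) :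
    ∫⁻ x, f x ^ q ∂μ ≤
      (C ^ θ : ℝ≥0) * (∫⁻ x, f x ^ (2 : ℝ) ∂μ) ^ (1 - θ + a * θ) * G ^ (b * θ) := by
  calc ∫⁻ x, f x ^ q ∂μ
      ≤ (∫⁻ x, f x ^ (2 : ℝ) ∂μ) ^ (1 - θ) * (∫⁻ x, f x ^ r ∂μ) ^ θ :=
        lintegral_rpow_le_interpolation hf zero_le_two hr hθ₀ hθ₁ hq
    _ ≤ (∫⁻ x, f x ^ (2 : ℝ) ∂μ) ^ (1 - θ) *
          (C * (∫⁻ x, f x ^ (2 : ℝ) ∂μ) ^ a * G ^ b) ^ θ := by gcongr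
    _ = _ := by
      rw [ENNReal.mul_rpow_of_nonneg _ _ hθ₀, ENNReal.mul_rpow_of_nonneg _ _ hθ₀,
        ← ENNReal.rpow_mul, ← ENNReal.rpow_mul, ENNReal.coe_rpow_of_nonneg _ hθ₀,
        ENNReal.rpow_add_of_nonneg _ _ (sub_nonneg.2 hθ₁) (mul_nonneg ha hθ₀)]
      ring

section

variable {E : Type*} [NormedAddCommGroup E] [NormedSpace ℝ E] [MeasurableSpace E] [BorelSpace E]

theorem lintegral_enorm_fderiv_pow_le [FiniteDimensional ℝ E] (μ : Measure E) {u : E → ℂ}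
    (hu : ContDiff ℝ 1 u) (m : ℕ) :
    ∫⁻ x, ‖fderiv ℝ (fun y ↦ u y ^ (m + 1)) x‖ₑ ∂μ ≤
      (m + 1 : ℝ≥0) * ((∫⁻ x, ‖u x‖ₑ ^ (2 * m : ℝ) ∂μ) ^ (1 / 2 : ℝ) *
        (∫⁻ x, ‖fderiv ℝ u x‖ₑ ^ (2 : ℝ) ∂μ) ^ (1 / 2 : ℝ)) := by
  have hu' : Continuous (fderiv ℝ u) := hu.continuous_fderiv one_ne_zero
  have hfd (x : E) : ‖fderiv ℝ (fun y ↦ u y ^ (m + 1)) x‖ₑ =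
      (m + 1 : ℝ≥0) * (‖u x‖ₑ ^ (m : ℝ) * ‖fderiv ℝ u x‖ₑ) := by
    rw [((hu.differentiable one_ne_zero x).hasFDerivAt.pow (m + 1)).fderiv, enorm_smul,
      nsmul_eq_mul, enorm_mul, enorm_pow, Nat.add_sub_cancel, ENNReal.rpow_natCast, mul_assoc]
    congr 1
    rw [← ofReal_norm, Complex.norm_natCast, ENNReal.ofReal_natCast]
    push_cast
    rfl
  simp_rw [hfd]
  rw [lintegral_const_mul' _ _ ENNReal.coe_ne_top]
  gcongr
  have hm : AEMeasurable (fun x ↦ ‖u x‖ₑ ^ (m : ℝ)) μ :=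
    (hu.continuous.enorm.measurable.pow_const _).aemeasurable
  refine (ENNReal.lintegral_mul_le_Lp_mul_Lq μ Real.HolderConjugate.two_two hm
    hu'.enorm.measurable.aemeasurable).trans (le_of_eq ?_)
  simp_rw [← ENNReal.rpow_mul, mul_comm (m : ℝ)]

/-- In dimension two, Sobolev's inequality for powers of `u` bounds the even moments of `u`. -/
theorem exists_lintegral_rpow_even_le [FiniteDimensional ℝ E] (μ : Measure E)
    [μ.IsAddHaarMeasure] (hE : Module.finrank ℝ E = 2) (k : ℕ) :
    ∃ C : ℝ≥0, ∀ u : E → ℂ, ContDiff ℝ 1 u → HasCompactSupport u →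
      ∫⁻ x, ‖u x‖ₑ ^ (2 * (k + 1) : ℝ) ∂μ ≤
        C * (∫⁻ x, ‖u x‖ₑ ^ (2 : ℝ) ∂μ) ^ (1 : ℝ) *
          (∫⁻ x, ‖fderiv ℝ u x‖ₑ ^ (2 : ℝ) ∂μ) ^ (k : ℝ) := by
  induction k with
  | zero => exact ⟨1, fun u _ _ ↦ by simp⟩
  | succ k ih =>
    obtain ⟨C, hC⟩ := ih
    refine ⟨lintegralPowLePowLIntegralFDerivConst μ 2 * (((k + 1 : ℕ) + 1) ^ 2 * C),
      fun u hu hcu ↦ ?_⟩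
    have hconj : (Module.finrank ℝ E : ℝ).HolderConjugate 2 := by
      rw [hE]; exact Real.HolderConjugate.two_two
    have hcpow : HasCompactSupport (fun x ↦ u x ^ (k + 1 + 1)) :=
      hcu.comp_left (g := fun z : ℂ ↦ z ^ (k + 1 + 1)) (by simp)
    have hS := lintegral_pow_le_pow_lintegral_fderiv μ (hu.pow (k + 1 + 1)) hcpow hconj
    set G := ∫⁻ x, ‖fderiv ℝ u x‖ₑ ^ (2 : ℝ) ∂μ with hG
    have hsq (a b c : ℝ≥0∞) : (a * (b ^ (1 / 2 : ℝ) * c ^ (1 / 2 : ℝ))) ^ (2 : ℝ) =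
        a ^ 2 * (b * c) := by
      rw [ENNReal.mul_rpow_of_nonneg _ _ zero_le_two, ENNReal.mul_rpow_of_nonneg _ _ zero_le_two,
        ← ENNReal.rpow_mul, ← ENNReal.rpow_mul]
      norm_num
    have hC' := hC u hu hcu
    calc ∫⁻ x, ‖u x‖ₑ ^ (2 * ((k + 1 : ℕ) + 1) : ℝ) ∂μ
        = ∫⁻ x, ‖u x ^ (k + 1 + 1)‖ₑ ^ (2 : ℝ) ∂μ := by
          refine lintegral_congr fun x ↦ ?_
          rw [enorm_pow, ← ENNReal.rpow_natCast, ← ENNReal.rpow_mul, mul_comm]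
          push_cast
          rfl
      _ ≤ lintegralPowLePowLIntegralFDerivConst μ 2 *
            (∫⁻ x, ‖fderiv ℝ (fun y ↦ u y ^ (k + 1 + 1)) x‖ₑ ∂μ) ^ (2 : ℝ) := hS
      _ ≤ lintegralPowLePowLIntegralFDerivConst μ 2 *
            (((k + 1 : ℕ) + 1 : ℝ≥0) * ((∫⁻ x, ‖u x‖ₑ ^ (2 * (k + 1 : ℕ) : ℝ) ∂μ) ^ (1 / 2 : ℝ) *
              G ^ (1 / 2 : ℝ))) ^ (2 : ℝ) := by
          gcongr
          exact lintegral_enorm_fderiv_pow_le μ hu (k + 1)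
      _ = lintegralPowLePowLIntegralFDerivConst μ 2 *
            (((k + 1 : ℕ) + 1 : ℝ≥0) ^ 2 * ((∫⁻ x, ‖u x‖ₑ ^ (2 * (k + 1) : ℝ) ∂μ) * G)) := by
          rw [hsq]
          push_cast
          rfl
      _ ≤ lintegralPowLePowLIntegralFDerivConst μ 2 * (((k + 1 : ℕ) + 1 : ℝ≥0) ^ 2 *
            (C * (∫⁻ x, ‖u x‖ₑ ^ (2 : ℝ) ∂μ) ^ (1 : ℝ) * G ^ (k : ℝ) * G)) := by gcongr
      _ = _ := by
          simp only [ENNReal.rpow_natCast, pow_succ]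
          push_cast
          ring

theorem exists_lintegral_rpow_le_of_finrank_eq_two [FiniteDimensional ℝ E] (μ : Measure E)
    [μ.IsAddHaarMeasure] (hE : Module.finrank ℝ E = 2) {p : ℝ} (hp : 1 < p) :
    ∃ K : ℝ≥0, ∀ u : E → ℂ, ContDiff ℝ 1 u → HasCompactSupport u →
      ∫⁻ x, ‖u x‖ₑ ^ (p + 1) ∂μ ≤
        K * (∫⁻ x, ‖u x‖ₑ ^ (2 : ℝ) ∂μ) ^ (1 : ℝ) *
          (∫⁻ x, ‖fderiv ℝ u x‖ₑ ^ (2 : ℝ) ∂μ) ^ ((p - 1) / 2) := by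
  obtain ⟨k, hk⟩ := exists_nat_ge ((p - 1) / 2)
  have hk₀ : (0 : ℝ) < k := by linarith
  obtain ⟨C, hC⟩ := exists_lintegral_rpow_even_le μ hE k
  refine ⟨C ^ ((p - 1) / (2 * k)), fun u hu hcu ↦ ?_⟩
  have hθ : (p - 1) / (2 * k) ≤ 1 := by rw [div_le_one (by positivity)]; linarith
  convert! lintegral_rpow_le_of_endpoint hu.continuous.enorm.measurable.aemeasurable
    (q := p + 1) (by positivity) (div_nonneg (by linarith) (by positivity)) hθ zero_le_one
    (by field_simp; ring) (hC u hu hcu) using 3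
  · ring_nf
  · field_simp

theorem exists_lintegral_rpow_le_of_three_le_finrank [FiniteDimensional ℝ E] (μ : Measure E)
    [μ.IsAddHaarMeasure] {n : ℕ} (hE : Module.finrank ℝ E = n) (hn : 3 ≤ n) {p : ℝ} (hp : 1 < p)
    (hp' : p < 1 + 4 / ((n : ℝ) - 2)) :
    ∃ K : ℝ≥0, ∀ u : E → ℂ, ContDiff ℝ 1 u → HasCompactSupport u →
      ∫⁻ x, ‖u x‖ₑ ^ (p + 1) ∂μ ≤
        K * (∫⁻ x, ‖u x‖ₑ ^ (2 : ℝ) ∂μ) ^ ((p + 1 - n * (p - 1) / 2) / 2) *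
          (∫⁻ x, ‖fderiv ℝ u x‖ₑ ^ (2 : ℝ) ∂μ) ^ (n * (p - 1) / 2 / 2) := by
  have hn₃ : (3 : ℝ) ≤ n := by exact_mod_cast hn
  have hn₂ : (0 : ℝ) < n - 2 := by linarith
  have hpn : (p - 1) * (n - 2) < 4 := by rw [← lt_div_iff₀ hn₂]; linarith
  let r : ℝ≥0 := ⟨2 * n / (n - 2), by positivity⟩
  have hr : (r : ℝ) = 2 * n / (n - 2) := rfl
  have hr₀ : r ≠ 0 := by
    rw [← NNReal.coe_ne_zero, hr]
    positivity
  let S := eLpNormLESNormFDerivOfEqInnerConst μ (2 : ℝ≥0)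
  refine ⟨(S ^ (r : ℝ)) ^ ((p - 1) * (n - 2) / 4), fun u hu hcu ↦ ?_⟩
  have hS : eLpNorm u r μ ≤ S * eLpNorm (fderiv ℝ u) (2 : ℝ≥0) μ := by
    refine eLpNorm_le_eLpNorm_fderiv_of_eq_inner μ hu hcu (by norm_num) (by omega) ?_
    rw [hr, hE]
    push_cast
    field_simp
  have hend : ∫⁻ x, ‖u x‖ₑ ^ (r : ℝ) ∂μ ≤ (S ^ (r : ℝ) : ℝ≥0) *
      (∫⁻ x, ‖u x‖ₑ ^ (2 : ℝ) ∂μ) ^ (0 : ℝ) *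
        (∫⁻ x, ‖fderiv ℝ u x‖ₑ ^ (2 : ℝ) ∂μ) ^ ((r : ℝ) / 2) := by
    have h2 : ∫⁻ x, ‖fderiv ℝ u x‖ₑ ^ (2 : ℝ) ∂μ = eLpNorm (fderiv ℝ u) (2 : ℝ≥0) μ ^ (2 : ℝ) :=
      (eLpNorm_nnreal_pow_eq_lintegral two_ne_zero).symm
    rw [h2, ← eLpNorm_nnreal_pow_eq_lintegral hr₀, ENNReal.rpow_zero, mul_one, ← ENNReal.rpow_mul,
      mul_div_cancel₀ _ two_ne_zero, ENNReal.coe_rpow_of_nonneg _ r.coe_nonneg,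
      ← ENNReal.mul_rpow_of_nonneg _ _ r.coe_nonneg]
    gcongr
  convert! lintegral_rpow_le_of_endpoint hu.continuous.enorm.measurable.aemeasurable
    (q := p + 1) r.2 (θ := (p - 1) * (n - 2) / 4)
    (div_nonneg (mul_nonneg (by linarith) hn₂.le) (by norm_num)) (by linarith) le_rfl ?_ hend using 3
  · ring_nf
  · rw [hr]; field_simp; ring
  · change p + 1 = _ + _ * (r : ℝ)
    rw [hr]; field_simp; ring

end

theorem enorm_le_lintegral_fderiv_of_dim_one {F : Type*} [NormedAddCommGroup F] [NormedSpace ℝ F]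
    {u : EuclideanSpace ℝ (Fin 1) → F} (hu : ContDiff ℝ 1 u) (hcu : HasCompactSupport u)
    (x : EuclideanSpace ℝ (Fin 1)) : ‖u x‖ₑ ≤ ∫⁻ y, ‖fderiv ℝ u y‖ₑ := by
  let e : ℝ ≃ₗᵢ[ℝ] EuclideanSpace ℝ (Fin 1) := (OrthonormalBasis.singleton (Fin 1) ℝ).repr
  have he : ContDiff ℝ 1 e := e.contDiff
  calc ‖u x‖ₑ = ‖(u ∘ e) (e.symm x)‖ₑ := by simp
    _ ≤ ∫⁻ t in Set.Iic (e.symm x), ‖deriv (u ∘ e) t‖ₑ :=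
        HasCompactSupport.enorm_le_lintegral_Ici_deriv (hu.comp he)
          (hcu.comp_homeomorph e.toHomeomorph) _
    _ ≤ ∫⁻ t, ‖deriv (u ∘ e) t‖ₑ := setLIntegral_le_lintegral _ _
    _ ≤ ∫⁻ t, ‖fderiv ℝ u (e t)‖ₑ := by
        refine lintegral_mono fun t ↦ ?_
        have hd : HasDerivAt e (e 1) t :=
          e.toContinuousLinearEquiv.toContinuousLinearMap.hasDerivAt
        rw [((hu.differentiable one_ne_zero (e t)).hasFDerivAt.comp_hasDerivAt t hd).deriv,
          enorm_le_iff_norm_le]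
        simpa using (fderiv ℝ u (e t)).le_opNorm (e 1)
    _ = ∫⁻ y, ‖fderiv ℝ u y‖ₑ :=
        e.measurePreserving.lintegral_comp_emb e.toHomeomorph.measurableEmbedding
          fun y ↦ ‖fderiv ℝ u y‖ₑ

theorem exists_lintegral_rpow_le_of_dim_one {p : ℝ} (hp : 1 < p) :
    ∃ K : ℝ≥0, ∀ u : EuclideanSpace ℝ (Fin 1) → ℂ, ContDiff ℝ 1 u → HasCompactSupport u →
      ∫⁻ x, ‖u x‖ₑ ^ (p + 1) ≤
        K * (∫⁻ x, ‖u x‖ₑ ^ (2 : ℝ)) ^ ((p + 1 - (p - 1) / 2) / 2) *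
          (∫⁻ x, ‖fderiv ℝ u x‖ₑ ^ (2 : ℝ)) ^ ((p - 1) / 2 / 2) := by
  refine ⟨2 ^ ((p - 1) / 2), fun u hu hcu ↦ ?_⟩
  have hp₁ : 0 ≤ (p - 1) / 2 := by linarith
  set A := ∫⁻ x, ‖u x‖ₑ ^ (2 : ℝ) with hA
  set G := ∫⁻ x, ‖fderiv ℝ u x‖ₑ ^ (2 : ℝ) with hG
  have hsup (x) : ‖u x‖ₑ ^ (2 : ℝ) ≤ (2 : ℝ≥0) * (A ^ (1 / 2 : ℝ) * G ^ (1 / 2 : ℝ)) := by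
    have hc : HasCompactSupport (fun x ↦ u x ^ (1 + 1)) :=
      hcu.comp_left (g := fun z : ℂ ↦ z ^ (1 + 1)) (by simp)
    have h := (enorm_le_lintegral_fderiv_of_dim_one (hu.pow (1 + 1)) hc x).trans
      (lintegral_enorm_fderiv_pow_le volume hu 1)
    rw [enorm_pow, ← ENNReal.rpow_natCast] at h
    norm_num [one_add_one_eq_two] at h
    simpa [hA, hG] using h
  calc ∫⁻ x, ‖u x‖ₑ ^ (p + 1)
      = ∫⁻ x, (‖u x‖ₑ ^ (2 : ℝ)) ^ ((p - 1) / 2) * ‖u x‖ₑ ^ (2 : ℝ) := by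
        refine lintegral_congr fun x ↦ ?_
        rw [← ENNReal.rpow_mul, ← ENNReal.rpow_add_of_nonneg _ _ (by linarith) zero_le_two]
        ring_nf
    _ ≤ ∫⁻ x, ((2 : ℝ≥0) * (A ^ (1 / 2 : ℝ) * G ^ (1 / 2 : ℝ))) ^ ((p - 1) / 2) *
          ‖u x‖ₑ ^ (2 : ℝ) := by
        gcongr with x
        exact hsup x
    _ = ((2 : ℝ≥0) * (A ^ (1 / 2 : ℝ) * G ^ (1 / 2 : ℝ))) ^ ((p - 1) / 2) * A :=
        lintegral_const_mul _ (hu.continuous.enorm.measurable.pow_const _)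
    _ = _ := by
        have hexp : (p + 1 - (p - 1) / 2) / 2 = 1 / 2 * ((p - 1) / 2) + 1 := by ring
        rw [ENNReal.mul_rpow_of_nonneg _ _ hp₁, ENNReal.mul_rpow_of_nonneg _ _ hp₁,
          ← ENNReal.rpow_mul, ← ENNReal.rpow_mul, ENNReal.coe_rpow_of_nonneg _ hp₁, hexp,
          ENNReal.rpow_add_of_nonneg _ _ (by linarith) zero_le_one, ENNReal.rpow_one]
        ring_nf

theorem integral_norm_rpow_eq_toReal_lintegral_enorm_rpow {α F : Type*} [MeasurableSpace α]
    [NormedAddCommGroup F] {μ : Measure α} {f : α → F} (hf : AEStronglyMeasurable f μ) {q : ℝ}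
    (hq : 0 ≤ q) : ∫ x, ‖f x‖ ^ q ∂μ = (∫⁻ x, ‖f x‖ₑ ^ q ∂μ).toReal := by
  rw [integral_eq_lintegral_of_nonneg_ae (Filter.Eventually.of_forall fun x ↦ by positivity)
    (hf.norm.aemeasurable.pow_const q).aestronglyMeasurable]
  congr 1
  refine lintegral_congr fun x ↦ ?_
  rw [← ENNReal.ofReal_rpow_of_nonneg (norm_nonneg _) hq, ofReal_norm]

theorem HasCompactSupport.lintegral_enorm_rpow_ne_top {X F : Type*} [TopologicalSpace X]
    [MeasurableSpace X] [OpensMeasurableSpace X] [NormedAddCommGroup F] {μ : Measure X}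
    [IsFiniteMeasureOnCompacts μ] {f : X → F} (hcf : HasCompactSupport f) (hf : Continuous f)
    {q : ℝ} (hq : 0 < q) : ∫⁻ x, ‖f x‖ₑ ^ q ∂μ ≠ ∞ := by
  have hint : Integrable (fun x ↦ ‖f x‖ ^ q) μ :=
    (hf.norm.rpow_const fun _ ↦ Or.inr hq.le).integrable_of_hasCompactSupport
      (hcf.comp_left (g := fun z ↦ ‖z‖ ^ q) (by simp [hq.ne']))
  have h := hint.lintegral_lt_top.ne
  simpa only [← ENNReal.ofReal_rpow_of_nonneg (norm_nonneg _) hq.le, ofReal_norm] using h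

/-- Gagliardo–Nirenberg interpolation inequality on `ℝ^N` in the energy-subcritical
range `1 < p < 1 + 4/(N−2)₊` (no upper bound when `N ≤ 2`), with `σ = N(p−1)/2`:
there exists `K > 0` such that for every compactly supported `C¹` function
`u : ℝ^N → ℂ`, `∫ |u|^{p+1} ≤ K ‖u‖_{L²}^{p+1−σ} ‖∇u‖_{L²}^{σ}`. -/
theorem gagliardo_nirenberg
    (N : ℕ) (hN : 1 ≤ N) (p : ℝ) (hp : 1 < p)
    (hp' : 3 ≤ N → p < 1 + 4 / ((N : ℝ) - 2)) :
    ∃ K : ℝ, 0 < K ∧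
      ∀ u : EuclideanSpace ℝ (Fin N) → ℂ,
        ContDiff ℝ 1 u → HasCompactSupport u →
        (∫ x, ‖u x‖ ^ (p + 1)) ≤
          K * ((∫ x, ‖u x‖ ^ (2:ℝ)) ^ ((1:ℝ) / 2)) ^ (p + 1 - (N : ℝ) * (p - 1) / 2)
            * ((∫ x, ‖fderiv ℝ u x‖ ^ (2:ℝ)) ^ ((1:ℝ) / 2)) ^ ((N : ℝ) * (p - 1) / 2) := by
  have hmain : ∃ K : ℝ≥0, ∀ u : EuclideanSpace ℝ (Fin N) → ℂ, ContDiff ℝ 1 u →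
      HasCompactSupport u → ∫⁻ x, ‖u x‖ₑ ^ (p + 1) ≤
        K * (∫⁻ x, ‖u x‖ₑ ^ (2 : ℝ)) ^ ((p + 1 - N * (p - 1) / 2) / 2) *
          (∫⁻ x, ‖fderiv ℝ u x‖ₑ ^ (2 : ℝ)) ^ (N * (p - 1) / 2 / 2) := by
    obtain rfl | rfl | hN₃ : N = 1 ∨ N = 2 ∨ 3 ≤ N := by omega
    · simpa only [Nat.cast_one, one_mul] using exists_lintegral_rpow_le_of_dim_one hp
    · convert! exists_lintegral_rpow_le_of_finrank_eq_two
        (E := EuclideanSpace ℝ (Fin 2)) volume (by simp) hp using 9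
      · push_cast; ring
      · push_cast; ring
    · exact exists_lintegral_rpow_le_of_three_le_finrank volume (by simp) hN₃ hp (hp' hN₃)
  have ha : 0 ≤ (p + 1 - (N : ℝ) * (p - 1) / 2) / 2 := by
    obtain hN₂ | hN₃ : N ≤ 2 ∨ 3 ≤ N := by omega
    · have : (N : ℝ) ≤ 2 := by exact_mod_cast hN₂
      nlinarith
    · have hn₃ : (3 : ℝ) ≤ N := by exact_mod_cast hN₃
      have hpn : (p - 1) * (N - 2) < 4 := by
        rw [← lt_div_iff₀ (by linarith)]
        linarith [hp' hN₃]
      linarith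
  have hb : 0 ≤ (N : ℝ) * (p - 1) / 2 / 2 := by
    have : 0 ≤ p - 1 := by linarith
    positivity
  obtain ⟨K, hK⟩ := hmain
  refine ⟨K + 1, by positivity, fun u hu hcu ↦ ?_⟩
  have hu' : Continuous (fderiv ℝ u) := hu.continuous_fderiv one_ne_zero
  rw [integral_norm_rpow_eq_toReal_lintegral_enorm_rpow hu.continuous.aestronglyMeasurable
      (by linarith : 0 ≤ p + 1),
    integral_norm_rpow_eq_toReal_lintegral_enorm_rpow hu.continuous.aestronglyMeasurable
      zero_le_two,
    integral_norm_rpow_eq_toReal_lintegral_enorm_rpow hu'.aestronglyMeasurable zero_le_two,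
    ← Real.rpow_mul ENNReal.toReal_nonneg, ← Real.rpow_mul ENNReal.toReal_nonneg,
    one_div_mul_eq_div, one_div_mul_eq_div]
  have hA := hcu.lintegral_enorm_rpow_ne_top (μ := volume) hu.continuous two_pos
  have hG := (hcu.fderiv ℝ).lintegral_enorm_rpow_ne_top (μ := volume) hu' two_pos
  have h := ENNReal.toReal_mono (ENNReal.mul_ne_top (ENNReal.mul_ne_top ENNReal.coe_ne_top
    (ENNReal.rpow_ne_top_of_nonneg ha hA)) (ENNReal.rpow_ne_top_of_nonneg hb hG)) (hK u hu hcu)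
  rw [ENNReal.toReal_mul, ENNReal.toReal_mul, ← ENNReal.toReal_rpow, ← ENNReal.toReal_rpow,
    ENNReal.coe_toReal] at h
  refine h.trans ?_
  gcongr
  linarith
end

section
/- Let a : [0,∞) → [0,∞) be a nonnegative continuous function with ∫₀^∞ a(s) ds = ∞ (i.e., ∫₀ᵗ a(s) ds → ∞ as t → ∞). Let E, I : [0,∞) → ℝ be continuous functions such that E is differentiable on (0,∞) with E′(t) = −2·a(t)·I(t) for all t > 0, and such that I(t) ≤ E(t) for all t ≥ 0. Then liminf_{t→∞} I(t) ≤ 0. -/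
open MeasureTheory Filter

/-- The integral of a function continuous on `[0, ∞)` is an antiderivative on `(0, ∞)`. -/
theorem hasDerivAt_integral_of_continuousOn_Ici {a : ℝ → ℝ}
    (ha : ContinuousOn a (Set.Ici 0)) {t : ℝ} (ht : 0 < t) :
    HasDerivAt (fun t => ∫ s in (0:ℝ)..t, a s) (a t) t := by
  refine intervalIntegral.integral_hasDerivAt_right ?_ ?_ (ha.continuousAt (Ici_mem_nhds ht))
  · refine ContinuousOn.intervalIntegrable (ha.mono ?_)
    rw [Set.uIcc_of_le ht.le]
    exact Set.Icc_subset_Ici_self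
  · exact (ha.mono Set.Ioi_subset_Ici_self).stronglyMeasurableAtFilter isOpen_Ioi t ht

/-- Abstract form of the lemma `liminf I(u(t)) ≤ 0`: if `a ≥ 0` is continuous with
divergent integral, `E` is continuous with `E′(t) = −2 a(t) I(t)` on `(0,∞)`, and
`I ≤ E` on `[0,∞)`, then `liminf_{t→∞} I(t) ≤ 0`. -/
theorem liminf_nonpos
    (a : ℝ → ℝ)
    (ha_cont : ContinuousOn a (Set.Ici 0))
    (ha_nonneg : ∀ t ∈ Set.Ici (0:ℝ), 0 ≤ a t)
    (hdiv : Tendsto (fun t => ∫ s in (0:ℝ)..t, a s) atTop atTop)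
    (E I : ℝ → ℝ)
    (hE_cont : ContinuousOn E (Set.Ici 0))
    (hI_cont : ContinuousOn I (Set.Ici 0))
    (hE_deriv : ∀ t ∈ Set.Ioi (0:ℝ), HasDerivAt E (-2 * a t * I t) t)
    (hIE : ∀ t ∈ Set.Ici (0:ℝ), I t ≤ E t) :
    liminf I atTop ≤ 0 := by
  rw [liminf_eq]
  refine Real.sSup_nonpos fun c hc => ?_
  by_contra! hc0
  obtain ⟨T, hT⟩ := eventually_atTop.1 (Eventually.and hc (eventually_gt_atTop 0))
  have hderiv : ∀ t, T ≤ t → HasDerivAt (fun t => E t + 2 * c * ∫ s in (0:ℝ)..t, a s)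
      (-2 * a t * I t + 2 * c * a t) t := fun t ht =>
    (hE_deriv t (hT t ht).2).add
      ((hasDerivAt_integral_of_continuousOn_Ici ha_cont (hT t ht).2).const_mul _)
  have hanti : AntitoneOn (fun t => E t + 2 * c * ∫ s in (0:ℝ)..t, a s) (Set.Ici T) := by
    refine antitoneOn_of_deriv_nonpos (convex_Ici T)
      (fun t ht => (hderiv t ht).continuousAt.continuousWithinAt)
      (fun t ht => (hderiv t (interior_subset ht)).differentiableAt.differentiableWithinAt)
      fun t ht => ?_
    have ht' := hT t (interior_subset ht)
    rw [(hderiv t (interior_subset ht)).deriv]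
    nlinarith [mul_nonneg (ha_nonneg t ht'.2.le) (sub_nonneg.2 ht'.1)]
  obtain ⟨t, hlarge, ht⟩ := ((Tendsto.const_mul_atTop (by positivity : 0 < 2 * c) hdiv
    |>.eventually_gt_atTop (E T + 2 * c * ∫ s in (0:ℝ)..T, a s)).and
    (eventually_ge_atTop T)).exists
  have hle := hanti Set.self_mem_Ici ht ht
  have hIE_t := hIE t (hT t ht).2.le
  have hcI := (hT t ht).1
  dsimp only at hle
  linarith
end
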